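/- arXiv:2009.01490 — 6 statements merged into one kernel-verified Lean document; each statement's English description precedes it below -/
import Mathlib

section
/- Let ξ be a time-based generator on [0, t_s] with parameters k > 0 and δ > 0, and let h(t) = k ξ'(t)/(1 − ξ(t) + δ). If V : ℝ → ℝ is differentiable, V(t) ≥ 0 for all t, and V'(t) ≤ −h(t) V(t) for all t ∈ [0, t_s], then V(t) ≤ ((1 − ξ(t) + δ)/(1 + δ))^k · V(0) for every t ∈ [0, t_s]; in particular V(t_s) ≤ (δ/(1 + δ))^k · V(0). -/
/-- A time-based generator on `[0, ts]`: a differentiable nondecreasing function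
`ξ : ℝ → ℝ` with `ξ 0 = 0`, `ξ ts = 1`, and `0 ≤ ξ t ≤ 1` on `[0, ts]`. -/
def IsTimeBasedGenerator (ts : ℝ) (ξ : ℝ → ℝ) : Prop :=
  Differentiable ℝ ξ ∧ Monotone ξ ∧ ξ 0 = 0 ∧ ξ ts = 1 ∧
    ∀ t ∈ Set.Icc (0 : ℝ) ts, 0 ≤ ξ t ∧ ξ t ≤ 1

/-- If `g` is positive on `[a, b]` and `V' ≤ k (g' / g) V` there, then `V * g ^ (-k)` is
nonincreasing on `[a, b]`. -/
theorem antitoneOn_mul_rpow_neg {a b k : ℝ} {g V : ℝ → ℝ}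
    (hg : Differentiable ℝ g) (hV : Differentiable ℝ V) (hpos : ∀ t ∈ Set.Icc a b, 0 < g t)
    (hV' : ∀ t ∈ Set.Icc a b, deriv V t ≤ k * deriv g t / g t * V t) :
    AntitoneOn (fun t ↦ V t * g t ^ (-k)) (Set.Icc a b) := by
  have hderiv : ∀ t ∈ Set.Icc a b, HasDerivAt (fun t ↦ V t * g t ^ (-k))
      (deriv V t * g t ^ (-k) + V t * (deriv g t * -k * g t ^ (-k - 1))) t := fun t ht ↦
    (hV t).hasDerivAt.mul ((hg t).hasDerivAt.rpow_const (Or.inl (hpos t ht).ne'))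
  refine antitoneOn_of_deriv_nonpos (convex_Icc a b)
    (fun t ht ↦ (hderiv t ht).continuousAt.continuousWithinAt)
    (fun t ht ↦ (hderiv t (interior_subset ht)).differentiableAt.differentiableWithinAt)
    fun t ht ↦ ?_
  replace ht := interior_subset ht
  have hgt := hpos t ht
  rw [(hderiv t ht).deriv, Real.rpow_sub_one hgt.ne']
  calc deriv V t * g t ^ (-k) + V t * (deriv g t * -k * (g t ^ (-k) / g t))
      = (deriv V t - k * deriv g t / g t * V t) * g t ^ (-k) := by ring
    _ ≤ 0 := mul_nonpos_of_nonpos_of_nonneg (sub_nonpos.2 (hV' t ht)) (by positivity)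

/-- if `V ≥ 0` is differentiable and `V' ≤ −h V` on `[0, ts]`, where
`h(t) = k ξ'(t)/(1 − ξ(t) + δ)`, then `V(t) ≤ ((1 − ξ(t) + δ)/(1 + δ))^k V(0)` on
`[0, ts]`; in particular `V(ts) ≤ (δ/(1 + δ))^k V(0)`. -/
theorem stmt2 (ts k δ : ℝ) (hts : 0 < ts) (hk : 0 < k) (hδ : 0 < δ)
    (ξ : ℝ → ℝ) (hξ : IsTimeBasedGenerator ts ξ)
    (h : ℝ → ℝ) (hh : ∀ t : ℝ, h t = k * deriv ξ t / (1 - ξ t + δ))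
    (V : ℝ → ℝ) (hVdiff : Differentiable ℝ V) (hVpos : ∀ t : ℝ, 0 ≤ V t)
    (hV' : ∀ t ∈ Set.Icc (0 : ℝ) ts, deriv V t ≤ -h t * V t) :
    (∀ t ∈ Set.Icc (0 : ℝ) ts, V t ≤ ((1 - ξ t + δ) / (1 + δ)) ^ k * V 0) ∧
      V ts ≤ (δ / (1 + δ)) ^ k * V 0 := by
  obtain ⟨hdiff, -, h0, h1, hbd⟩ := hξ
  have hpos : ∀ t ∈ Set.Icc (0 : ℝ) ts, 0 < 1 - ξ t + δ := fun t ht ↦ by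
    linarith [(hbd t ht).2]
  have hanti : AntitoneOn (fun t ↦ V t * (1 - ξ t + δ) ^ (-k)) (Set.Icc 0 ts) := by
    refine antitoneOn_mul_rpow_neg (by fun_prop) hVdiff hpos fun t ht ↦ (hV' t ht).trans_eq ?_
    have hderiv : deriv (fun t ↦ 1 - ξ t + δ) t = -deriv ξ t := by simp
    rw [hh, hderiv]
    ring
  have main : ∀ t ∈ Set.Icc (0 : ℝ) ts, V t ≤ ((1 - ξ t + δ) / (1 + δ)) ^ k * V 0 := by
    intro t ht
    have hle := hanti (Set.left_mem_Icc.2 hts.le) ht ht.1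
    have hgt := hpos t ht
    simp only [h0, sub_zero] at hle
    rw [Real.rpow_neg hgt.le, Real.rpow_neg (by positivity), ← div_eq_mul_inv,
      div_le_iff₀ (by positivity)] at hle
    rw [Real.div_rpow hgt.le (by positivity)]
    exact hle.trans_eq (by ring)
  exact ⟨main, by simpa [h1] using main ts (Set.right_mem_Icc.2 hts.le)⟩
end

section
/- Let V : ℝ → ℝ be differentiable and nonnegative, and suppose there exist constants μ > 0 and ν ∈ (0, 1) such that V'(t) + μ V(t)^ν ≤ 0 for all t ≥ 0. Then V(t) = 0 for every t ≥ V(0)^(1−ν) / (μ(1 − ν)); that is, V converges to zero in a finite time T bounded by T ≤ V(0)^(1−ν) / (μ(1 − ν)). -/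
/-- if `V` is differentiable, nonnegative, and satisfies
`V'(t) + μ V(t)^ν ≤ 0` for all `t ≥ 0` with `μ > 0` and `ν ∈ (0, 1)`, then
`V(t) = 0` for every `t ≥ V(0)^(1−ν)/(μ(1−ν))`. -/
theorem stmt3 (V : ℝ → ℝ) (hVdiff : Differentiable ℝ V) (hVpos : ∀ t : ℝ, 0 ≤ V t)
    (μ ν : ℝ) (hμ : 0 < μ) (hν : ν ∈ Set.Ioo (0 : ℝ) 1)
    (hV' : ∀ t : ℝ, 0 ≤ t → deriv V t + μ * V t ^ ν ≤ 0) :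
    ∀ t : ℝ, V 0 ^ (1 - ν) / (μ * (1 - ν)) ≤ t → V t = 0 := by
  obtain ⟨hν0, hν1⟩ := hν
  intro t ht
  have hc : 0 < μ * (1 - ν) := mul_pos hμ (sub_pos.2 hν1)
  have ht0 : 0 ≤ t := (div_nonneg (Real.rpow_nonneg (hVpos 0) _) hc.le).trans ht
  have hanti : AntitoneOn V (Set.Icc 0 t) := by
    refine antitoneOn_of_deriv_nonpos (convex_Icc 0 t) hVdiff.continuous.continuousOn
      hVdiff.differentiableOn fun s hs => ?_
    rw [interior_Icc] at hs
    linarith [hV' s hs.1.le, mul_nonneg hμ.le (Real.rpow_nonneg (hVpos s) ν)]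
  by_contra hne
  have hVt : 0 < V t := (hVpos t).lt_of_ne' hne
  have hpos : ∀ s ∈ Set.Icc 0 t, 0 < V s := fun s hs =>
    hVt.trans_le (hanti hs (Set.right_mem_Icc.2 ht0) hs.2)
  have hderiv : ∀ s ∈ Set.Icc 0 t,
      HasDerivAt (fun s => V s ^ (1 - ν) + μ * (1 - ν) * s)
        (deriv V s * (1 - ν) * V s ^ (1 - ν - 1) + μ * (1 - ν) * 1) s := fun s hs =>
    ((hVdiff s).hasDerivAt.rpow_const (Or.inl (hpos s hs).ne')).add
      ((hasDerivAt_id s).const_mul _)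
  have hW : AntitoneOn (fun s => V s ^ (1 - ν) + μ * (1 - ν) * s) (Set.Icc 0 t) := by
    refine antitoneOn_of_deriv_nonpos (convex_Icc 0 t)
      (fun s hs => (hderiv s hs).continuousAt.continuousWithinAt)
      (fun s hs => (hderiv s (interior_subset hs)).differentiableAt.differentiableWithinAt)
      fun s hs => ?_
    have hs' := interior_subset hs
    rw [(hderiv s hs').deriv]
    have hmul : V s ^ ν * V s ^ (1 - ν - 1) = 1 := by
      rw [← Real.rpow_add (hpos s hs'), show ν + (1 - ν - 1) = 0 by ring, Real.rpow_zero]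
    calc deriv V s * (1 - ν) * V s ^ (1 - ν - 1) + μ * (1 - ν) * 1
        = (deriv V s + μ * V s ^ ν) * ((1 - ν) * V s ^ (1 - ν - 1)) := by
          linear_combination -(μ * (1 - ν)) * hmul
      _ ≤ 0 := mul_nonpos_of_nonpos_of_nonneg (hV' s hs'.1)
          (mul_nonneg (sub_pos.2 hν1).le (Real.rpow_nonneg (hVpos s) _))
  have hle := hW (Set.left_mem_Icc.2 ht0) (Set.right_mem_Icc.2 ht0) ht0
  have hT := (div_le_iff₀ hc).1 ht
  have hVt' := Real.rpow_pos_of_pos hVt (1 - ν)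
  dsimp only at hle
  linarith
end

section
/- Let ξ be a time-based generator on [0, t_{a1}] with parameters k > 0 and δ > 0, and let h(t) = k ξ'(t)/(1 − ξ(t) + δ). Let ρ > 0 and ϱ : ℝ → ℝ satisfy |ϱ(t)| ≤ ρ − 1 for all t. If s : ℝ → ℝ is differentiable and satisfies s'(t) = −(1/2) h(t) s(t) − ρ · sgn(s(t)) + ϱ(t) for all t ∈ [0, t_{a1}], then s(t)² ≤ ((1 − ξ(t) + δ)/(1 + δ))^k · s(0)² for every t ∈ [0, t_{a1}]. -/
/-- If `V' ≤ k (u' / u) V` with `u > 0`, then `V * u ^ (-k)` is nonincreasing. -/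
theorem antitoneOn_mul_rpow_neg_of_deriv_le {D : Set ℝ} (hD : Convex ℝ D) {k : ℝ}
    {u V u' V' : ℝ → ℝ} (hu : ∀ t ∈ D, HasDerivAt u (u' t) t)
    (hV : ∀ t ∈ D, HasDerivAt V (V' t) t) (hpos : ∀ t ∈ D, 0 < u t)
    (hle : ∀ t ∈ D, V' t ≤ k * u' t / u t * V t) :
    AntitoneOn (fun t => V t * u t ^ (-k)) D := by
  have hderiv : ∀ t ∈ D, HasDerivAt (fun t => V t * u t ^ (-k))
      (V' t * u t ^ (-k) + V t * (u' t * (-k) * u t ^ (-k - 1))) t := fun t ht =>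
    (hV t ht).mul ((hu t ht).rpow_const (Or.inl (hpos t ht).ne'))
  refine antitoneOn_of_hasDerivWithinAt_nonpos hD
    (fun t ht => (hderiv t ht).continuousAt.continuousWithinAt)
    (fun t ht => (hderiv t (interior_subset ht)).hasDerivWithinAt) fun t ht => ?_
  have htD := interior_subset ht
  have heq : V' t * u t ^ (-k) + V t * (u' t * (-k) * u t ^ (-k - 1)) =
      u t ^ (-k) * (V' t - k * u' t / u t * V t) := by
    rw [Real.rpow_sub_one (hpos t htD).ne']
    ring
  rw [heq]
  exact mul_nonpos_of_nonneg_of_nonpos (Real.rpow_nonneg (hpos t htD).le _)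
    (sub_nonpos.mpr (hle t htD))

/-- reaching phase of the sliding mode control.  With gain
`h(t) = k ξ'(t)/(1 − ξ(t) + δ)`, `ρ > 0`, disturbance `|ϱ(t)| ≤ ρ − 1`, and the
sliding dynamics `s' = −(1/2) h s − ρ sgn(s) + ϱ` on `[0, t_{a1}]`, one has
`s(t)² ≤ ((1 − ξ(t) + δ)/(1 + δ))^k s(0)²` on `[0, t_{a1}]`. -/
theorem stmt10 (ta1 k δ : ℝ) (hta1 : 0 < ta1) (hk : 0 < k) (hδ : 0 < δ)
    (ξ : ℝ → ℝ) (hξ : IsTimeBasedGenerator ta1 ξ)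
    (h : ℝ → ℝ) (hh : ∀ t : ℝ, h t = k * deriv ξ t / (1 - ξ t + δ))
    (ρ : ℝ) (hρ : 0 < ρ) (ϱ : ℝ → ℝ) (hϱ : ∀ t : ℝ, |ϱ t| ≤ ρ - 1)
    (s : ℝ → ℝ) (hsdiff : Differentiable ℝ s)
    (hs' : ∀ t ∈ Set.Icc (0 : ℝ) ta1,
      deriv s t = -(1 / 2) * h t * s t - ρ * Real.sign (s t) + ϱ t) :
    ∀ t ∈ Set.Icc (0 : ℝ) ta1,
      s t ^ 2 ≤ ((1 - ξ t + δ) / (1 + δ)) ^ k * s 0 ^ 2 := by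
  obtain ⟨hξd, -, hξ0, -, hξb⟩ := hξ
  intro t ht
  have hpos : ∀ x ∈ Set.Icc (0 : ℝ) ta1, 0 < 1 - ξ x + δ := fun x hx => by
    linarith [(hξb x hx).2]
  have hu : ∀ x ∈ Set.Icc (0 : ℝ) ta1,
      HasDerivAt (fun x => 1 - ξ x + δ) (-deriv ξ x) x := fun x _ =>
    ((hξd x).hasDerivAt.const_sub 1).add_const δ
  have hV : ∀ x ∈ Set.Icc (0 : ℝ) ta1,
      HasDerivAt (fun x => s x ^ 2) (2 * s x * deriv s x) x := fun x _ => by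
    simpa using (hsdiff x).hasDerivAt.fun_pow 2
  have hle : ∀ x ∈ Set.Icc (0 : ℝ) ta1,
      2 * s x * deriv s x ≤ k * -deriv ξ x / (1 - ξ x + δ) * s x ^ 2 := fun x hx => by
    have hdist : s x * ϱ x ≤ ρ * (s x * Real.sign (s x)) := by
      obtain ⟨hlo, hhi⟩ := abs_le.mp (hϱ x)
      rcases lt_trichotomy (s x) 0 with hs | hs | hs
      · rw [Real.sign_of_neg hs]
        nlinarith
      · simp [hs]
      · rw [Real.sign_of_pos hs]
        nlinarith
    have hgain : k * -deriv ξ x / (1 - ξ x + δ) = -h x := by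
      rw [hh x]
      ring
    rw [hgain, hs' x hx]
    linarith
  have hanti := antitoneOn_mul_rpow_neg_of_deriv_le (convex_Icc 0 ta1) hu hV hpos hle
    (Set.left_mem_Icc.mpr hta1.le) ht ht.1
  simp only [hξ0, sub_zero] at hanti
  have hut := hpos t ht
  rw [Real.rpow_neg hut.le, Real.rpow_neg (by positivity), ← div_eq_mul_inv,
    ← div_eq_mul_inv, div_le_iff₀ (by positivity)] at hanti
  rw [Real.div_rpow hut.le (by positivity)]
  exact hanti.trans_eq (by ring)
end

section
/- Let ξ be a time-based generator on [0, t_s] with parameters k > 0 and δ > 0, and let h(t) = k ξ'(t)/(1 − ξ(t) + δ). If z : ℝ → ℝ is differentiable and satisfies z'(t) = −((1/2) h(t) + 1) z(t) for all t ≥ 0, then (i) |z(t)| ≤ e^{−t} |z(0)| for all t ≥ 0, and (ii) z(t)² ≤ ((1 − ξ(t) + δ)/(1 + δ))^k · z(0)² for all t ∈ [0, t_s]. -/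
lemma IsTimeBasedGenerator.denom_pos {ts δ t : ℝ} {ξ : ℝ → ℝ} (hξ : IsTimeBasedGenerator ts ξ)
    (hδ : 0 < δ) (ht : t ∈ Set.Icc (0 : ℝ) ts) : 0 < 1 - ξ t + δ := by
  have := (hξ.2.2.2.2 t ht).2
  linarith

/-- A solution of `z' = -(h / 2 + 1) z` with `h ≥ 0` decays at least as fast as `exp (-t)`. -/
lemma abs_le_exp_neg_mul_of_deriv_eq {h z : ℝ → ℝ} (hh : ∀ t, 0 ≤ t → 0 ≤ h t)
    (hzdiff : Differentiable ℝ z)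
    (hz' : ∀ t : ℝ, 0 ≤ t → deriv z t = -((1 / 2) * h t + 1) * z t) {t : ℝ} (ht : 0 ≤ t) :
    |z t| ≤ Real.exp (-t) * |z 0| := by
  have hd : ∀ s, HasDerivAt (fun s => (Real.exp s * z s) ^ 2)
      (2 * (Real.exp s * z s) * (Real.exp s * z s + Real.exp s * deriv z s)) s := fun s => by
    simpa using ((Real.hasDerivAt_exp s).fun_mul (hzdiff s).hasDerivAt).fun_pow 2
  have hanti : AntitoneOn (fun s => (Real.exp s * z s) ^ 2) (Set.Ici 0) := by
    refine antitoneOn_of_hasDerivWithinAt_nonpos (convex_Ici 0)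
      (fun s _ => (hd s).continuousAt.continuousWithinAt)
      (fun s _ => (hd s).hasDerivWithinAt) fun s hs => ?_
    have hs0 : 0 ≤ s := interior_subset hs
    rw [hz' s hs0]
    have := mul_nonneg (hh s hs0) (sq_nonneg (Real.exp s * z s))
    linarith
  have hle := sq_le_sq.mp (hanti Set.self_mem_Ici ht ht)
  rw [Real.exp_zero, one_mul, abs_mul, Real.abs_exp] at hle
  calc |z t| = Real.exp (-t) * (Real.exp t * |z t|) := by
        rw [← mul_assoc, ← Real.exp_add, neg_add_cancel, Real.exp_zero, one_mul]
    _ ≤ Real.exp (-t) * |z 0| := by gcongr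

/-- A solution of `z' = -(h / 2 + 1) z`, where `h = -k g' / g` with `g > 0`, satisfies
`z ^ 2 ≤ (g / g 0) ^ k * z 0 ^ 2`. -/
lemma sq_le_rpow_mul_sq_of_deriv_eq {T k : ℝ} {g h z : ℝ → ℝ}
    (hg : Differentiable ℝ g) (hpos : ∀ t ∈ Set.Icc 0 T, 0 < g t)
    (hh : ∀ t ∈ Set.Icc 0 T, h t = -(k * deriv g t) / g t) (hzdiff : Differentiable ℝ z)
    (hz' : ∀ t : ℝ, 0 ≤ t → deriv z t = -((1 / 2) * h t + 1) * z t) {t : ℝ}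
    (ht : t ∈ Set.Icc 0 T) : z t ^ 2 ≤ (g t / g 0) ^ k * z 0 ^ 2 := by
  have hd : ∀ s ∈ Set.Icc 0 T, HasDerivAt (fun s => z s ^ 2 * g s ^ (-k))
      (2 * z s * deriv z s * g s ^ (-k) +
        z s ^ 2 * (deriv g s * (-k) * g s ^ (-k - 1))) s := fun s hs => by
    simpa using ((hzdiff s).hasDerivAt.fun_pow 2).fun_mul
      ((hg s).hasDerivAt.rpow_const (p := -k) (Or.inl (hpos s hs).ne'))
  have hanti : AntitoneOn (fun s => z s ^ 2 * g s ^ (-k)) (Set.Icc 0 T) := by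
    refine antitoneOn_of_hasDerivWithinAt_nonpos (convex_Icc 0 T)
      (fun s hs => (hd s hs).continuousAt.continuousWithinAt)
      (fun s hs => (hd s (interior_subset hs)).hasDerivWithinAt) fun s hs => ?_
    have hs' := interior_subset hs
    have hgs := hpos s hs'
    have heq : 2 * z s * deriv z s * g s ^ (-k) +
        z s ^ 2 * (deriv g s * (-k) * g s ^ (-k - 1)) = -(2 * (z s ^ 2 * g s ^ (-k))) := by
      rw [hz' s hs'.1, hh s hs', Real.rpow_sub_one hgs.ne']
      field_simp
      ring
    rw [heq, neg_nonpos]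
    positivity
  have h0 : (0 : ℝ) ∈ Set.Icc 0 T := ⟨le_rfl, ht.1.trans ht.2⟩
  have hgt := hpos t ht
  have hle := hanti h0 ht ht.1
  simp only [Real.rpow_neg hgt.le, Real.rpow_neg (hpos 0 h0).le] at hle
  rw [Real.div_rpow hgt.le (hpos 0 h0).le]
  have hgk : 0 < g t ^ k := Real.rpow_pos_of_pos hgt k
  calc z t ^ 2 = g t ^ k * (z t ^ 2 * (g t ^ k)⁻¹) := by field_simp
    _ ≤ g t ^ k * (z 0 ^ 2 * (g 0 ^ k)⁻¹) := by gcongr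
    _ = g t ^ k / g 0 ^ k * z 0 ^ 2 := by ring

/-- sliding phase.  With gain `h(t) = k ξ'(t)/(1 − ξ(t) + δ)` on
`[0, ts]` and `h(t) = 0` for `t > ts`, if `z' = −((1/2) h + 1) z` for all
`t ≥ 0`, then (i) `|z(t)| ≤ e^{−t} |z(0)|` for all `t ≥ 0`, and
(ii) `z(t)² ≤ ((1 − ξ(t) + δ)/(1 + δ))^k z(0)²` on `[0, ts]`. -/
theorem stmt12 (ts k δ : ℝ) (hts : 0 < ts) (hk : 0 < k) (hδ : 0 < δ)
    (ξ : ℝ → ℝ) (hξ : IsTimeBasedGenerator ts ξ)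
    (h : ℝ → ℝ)
    (hh1 : ∀ t ∈ Set.Icc (0 : ℝ) ts, h t = k * deriv ξ t / (1 - ξ t + δ))
    (hh2 : ∀ t : ℝ, ts < t → h t = 0)
    (z : ℝ → ℝ) (hzdiff : Differentiable ℝ z)
    (hz' : ∀ t : ℝ, 0 ≤ t → deriv z t = -((1 / 2) * h t + 1) * z t) :
    (∀ t : ℝ, 0 ≤ t → |z t| ≤ Real.exp (-t) * |z 0|) ∧
      ∀ t ∈ Set.Icc (0 : ℝ) ts, z t ^ 2 ≤ ((1 - ξ t + δ) / (1 + δ)) ^ k * z 0 ^ 2 := by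
  refine ⟨fun t ht => abs_le_exp_neg_mul_of_deriv_eq (fun s hs => ?_) hzdiff hz' ht,
    fun t ht => ?_⟩
  · rcases le_or_gt s ts with hs1 | hs1
    · rw [hh1 s ⟨hs, hs1⟩]
      exact div_nonneg (mul_nonneg hk.le hξ.2.1.deriv_nonneg) (hξ.denom_pos hδ ⟨hs, hs1⟩).le
    · exact (hh2 s hs1).ge
  · have hd : ∀ s, HasDerivAt (fun s => 1 - ξ s + δ) (-deriv ξ s) s := fun s =>
      ((hξ.1 s).hasDerivAt.const_sub 1).add_const δ
    have := sq_le_rpow_mul_sq_of_deriv_eq (k := k) (fun s => (hd s).differentiableAt)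
      (fun s hs => hξ.denom_pos hδ hs)
      (fun s hs => by rw [hh1 s hs, (hd s).deriv]; ring) hzdiff hz' ht
    simpa only [hξ.2.2.1, sub_zero] using this
end

section
/- Let h : ℝ → ℝ be nonnegative, let ē ≥ 0, and let e : ℝ → ℝ satisfy |e(t)| ≤ ē for all t ≥ 0. If z : ℝ → ℝ is differentiable and satisfies z'(t) = −((1/2) h(t) + 1) z(t) + e(t) for all t ≥ 0, then |z(t)| ≤ e^{−t} |z(0)| + ē for all t ≥ 0. -/
/-- A solution of `z' = -(g + 1) z + e` with `g ≥ 0` and `e ≤ c` on `[0, ∞)`, where `c ≥ 0`,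
stays below `exp (-t) * a + c` whenever `z 0 ≤ a` and `a ≥ 0`. -/
theorem le_exp_neg_mul_add_of_deriv_eq {g e z : ℝ → ℝ} {a c : ℝ} (ha : 0 ≤ a) (hc : 0 ≤ c)
    (hg : ∀ t, 0 ≤ t → 0 ≤ g t) (he : ∀ t, 0 ≤ t → e t ≤ c) (hz₀ : z 0 ≤ a)
    (hz : ∀ t, 0 ≤ t → HasDerivAt z (-(g t + 1) * z t + e t) t) {t : ℝ} (ht : 0 ≤ t) :
    z t ≤ Real.exp (-t) * a + c := by
  refine le_of_forall_pos_le_add fun δ hδ => ?_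
  have hB : ∀ x, HasDerivAt (fun x => Real.exp (-x) * a + c + δ) (-(Real.exp (-x) * a)) x := by
    intro x
    exact ((((hasDerivAt_id' x).fun_neg.exp).mul_const a).add_const c).add_const δ
      |>.congr_deriv (by ring)
  refine image_le_of_deriv_right_lt_deriv_boundary (a := 0) (b := t)
    (fun x hx => (hz x hx.1).continuousAt.continuousWithinAt)
    (fun x hx => (hz x hx.1).hasDerivWithinAt) ?_ hB ?_ ⟨ht, le_rfl⟩
  · simp only [neg_zero, Real.exp_zero, one_mul]
    linarith
  · intro x hx hzx
    have hexp : 0 ≤ Real.exp (-x) * a := by positivity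
    have hzpos : 0 ≤ z x := by rw [hzx]; positivity
    have hgz := mul_nonneg (hg x hx.1) hzpos
    linarith [he x hx.1]

/-- perturbed sliding phase.  If `h ≥ 0`, `|e(t)| ≤ ē` for `t ≥ 0`,
and `z' = −((1/2) h + 1) z + e` for all `t ≥ 0`, then
`|z(t)| ≤ e^{−t} |z(0)| + ē` for all `t ≥ 0`. -/
theorem stmt13 (h : ℝ → ℝ) (hh : ∀ t : ℝ, 0 ≤ h t)
    (ebar : ℝ) (hebar : 0 ≤ ebar) (e : ℝ → ℝ) (he : ∀ t : ℝ, 0 ≤ t → |e t| ≤ ebar)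
    (z : ℝ → ℝ) (hzdiff : Differentiable ℝ z)
    (hz' : ∀ t : ℝ, 0 ≤ t → deriv z t = -((1 / 2) * h t + 1) * z t + e t) :
    ∀ t : ℝ, 0 ≤ t → |z t| ≤ Real.exp (-t) * |z 0| + ebar := by
  intro t ht
  have hg : ∀ s, 0 ≤ s → 0 ≤ 1 / 2 * h s := fun s _ => mul_nonneg (by norm_num) (hh s)
  have hz : ∀ s, 0 ≤ s → HasDerivAt z (-(1 / 2 * h s + 1) * z s + e s) s := fun s hs =>
    hz' s hs ▸ (hzdiff s).hasDerivAt
  refine abs_le'.2 ⟨?_, ?_⟩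
  · exact le_exp_neg_mul_add_of_deriv_eq (abs_nonneg _) hebar hg
      (fun s hs => (abs_le'.1 (he s hs)).1) (le_abs_self _) hz ht
  · refine le_exp_neg_mul_add_of_deriv_eq (z := fun s => -z s) (e := fun s => -e s)
      (abs_nonneg _) hebar hg (fun s hs => (abs_le'.1 (he s hs)).2) (neg_le_abs _)
      (fun s hs => ?_) ht
    exact (hz s hs).fun_neg.congr_deriv (by ring)
end

section
/- Let Q ∈ ℝ^{n×n} be a symmetric positive definite matrix with smallest eigenvalue λ₁(Q) > 0, let h ≥ 0, M ≥ 0, c₂ ≥ M, and c₁ ≥ 1/(2λ₁(Q)). Then for every β ∈ ℝⁿ and every g ∈ ℝⁿ with |gᵢ| ≤ M for all i, the following dissipation inequality holds: βᵀQ(−c₁ h Qβ − c₂ sgn(Qβ) + g) ≤ −h · (1/2) βᵀQβ − (c₂ − M) ‖Qβ‖₁. -/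
open Matrix

/-- A lower bound `r` for the eigenvalues of a positive semidefinite real matrix `Q` satisfies
`r * βᵀQβ ≤ (Qβ)ᵀ(Qβ)`. -/
theorem Matrix.PosSemidef.mul_dotProduct_mulVec_le {ι : Type*} [Fintype ι]
    {Q : Matrix ι ι ℝ} (hQ : Q.PosSemidef) {r : ℝ}
    (hr : ∀ (s : ℝ) (v : ι → ℝ), v ≠ 0 → Q *ᵥ v = s • v → r ≤ s) (β : ι → ℝ) :
    r * (β ⬝ᵥ (Q *ᵥ β)) ≤ (Q *ᵥ β) ⬝ᵥ (Q *ᵥ β) := by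
  classical
  set b := hQ.isHermitian.eigenvectorBasis
  set μ := hQ.isHermitian.eigenvalues
  have expand (x y : ι → ℝ) : x ⬝ᵥ y = ∑ i, (b i ⬝ᵥ x) * (b i ⬝ᵥ y) := by
    have := b.sum_inner_mul_inner (WithLp.toLp 2 x) (WithLp.toLp 2 y)
    simp only [EuclideanSpace.inner_eq_star_dotProduct, star_trivial] at this
    rw [dotProduct_comm x y, ← this]
    simp only [dotProduct_comm]
  have eigen (i : ι) : Q *ᵥ b i = μ i • (b i).ofLp :=
    hQ.isHermitian.mulVec_eigenvectorBasis i
  have coord (i : ι) : b i ⬝ᵥ (Q *ᵥ β) = μ i * (b i ⬝ᵥ β) := by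
    have hT : Qᵀ = Q := by simpa using hQ.isHermitian.eq
    rw [dotProduct_mulVec, ← mulVec_transpose, hT, eigen, smul_dotProduct, smul_eq_mul]
  have hle (i : ι) : r ≤ μ i := by
    refine hr _ _ (fun h0 => b.orthonormal.ne_zero i ?_) (eigen i)
    ext j
    exact congrFun h0 j
  rw [expand β, expand (Q *ᵥ β), Finset.mul_sum]
  refine Finset.sum_le_sum fun i _ => ?_
  rw [coord]
  have := mul_le_mul_of_nonneg_right (hle i)
    (mul_nonneg (hQ.eigenvalues_nonneg i) (sq_nonneg (b i ⬝ᵥ β)))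
  linear_combination this

/-- dissipation inequality for the undirected consensus-tracking
observer.  For a symmetric positive definite `Q` with smallest eigenvalue
`λ₁(Q)`, `h ≥ 0`, `M ≥ 0`, `c₂ ≥ M`, `c₁ ≥ 1/(2λ₁(Q))`, any `β` and any `g`
with `|gᵢ| ≤ M`:
`βᵀQ(−c₁ h Qβ − c₂ sgn(Qβ) + g) ≤ −h (1/2) βᵀQβ − (c₂ − M) ‖Qβ‖₁`. -/
theorem stmt14 (n : ℕ) (Q : Matrix (Fin n) (Fin n) ℝ) (hQ : Q.PosDef)
    (lam1 : ℝ)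
    (hlam1 : IsLeast {r : ℝ | ∃ v : Fin n → ℝ, v ≠ 0 ∧ Q *ᵥ v = r • v} lam1)
    (h M c₁ c₂ : ℝ) (hh : 0 ≤ h) (hM : 0 ≤ M) (hc₂ : M ≤ c₂)
    (hc₁ : 1 / (2 * lam1) ≤ c₁)
    (β : Fin n → ℝ) (g : Fin n → ℝ) (hg : ∀ i, |g i| ≤ M) :
    β ⬝ᵥ (Q *ᵥ fun i => -c₁ * h * (Q *ᵥ β) i - c₂ * Real.sign ((Q *ᵥ β) i) + g i) ≤
      -h * (1 / 2) * (β ⬝ᵥ (Q *ᵥ β)) - (c₂ - M) * ∑ i, |(Q *ᵥ β) i| := by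
  have hpos : 0 < lam1 := by
    obtain ⟨v, hv, hQv⟩ := hlam1.1
    have h1 : 0 < v ⬝ᵥ (Q *ᵥ v) := by simpa using hQ.dotProduct_mulVec_pos hv
    rw [hQv, dotProduct_smul, smul_eq_mul] at h1
    exact pos_of_mul_pos_left h1 (by simpa using dotProduct_star_self_nonneg v)
  have key := hQ.posSemidef.mul_dotProduct_mulVec_le
    (fun s v hv hs => hlam1.2 ⟨v, hv, hs⟩) β
  have hT : Qᵀ = Q := by simpa using hQ.isHermitian.eq
  rw [dotProduct_mulVec, ← mulVec_transpose, hT]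
  set y := Q *ᵥ β
  have hy : 0 ≤ y ⬝ᵥ y := by simpa using dotProduct_star_self_nonneg y
  have quad : 1 / 2 * (β ⬝ᵥ y) ≤ c₁ * (y ⬝ᵥ y) := calc
    1 / 2 * (β ⬝ᵥ y) = 1 / (2 * lam1) * (lam1 * (β ⬝ᵥ y)) := by field_simp
    _ ≤ 1 / (2 * lam1) * (y ⬝ᵥ y) := by gcongr
    _ ≤ c₁ * (y ⬝ᵥ y) := by gcongr
  have term (i : Fin n) : y i * (-c₁ * h * y i - c₂ * Real.sign (y i) + g i) ≤
      -c₁ * h * (y i * y i) - (c₂ - M) * |y i| := by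
    have hsign : y i * Real.sign (y i) = |y i| := by
      rcases lt_trichotomy (y i) 0 with hi | hi | hi
      · simp [Real.sign_of_neg hi, abs_of_neg hi]
      · simp [hi]
      · simp [Real.sign_of_pos hi, abs_of_pos hi]
    have hgi : y i * g i ≤ |y i| * M :=
      (le_abs_self _).trans (by rw [abs_mul]; gcongr; exact hg i)
    linear_combination hgi - c₂ * hsign
  have total : y ⬝ᵥ (fun i => -c₁ * h * y i - c₂ * Real.sign (y i) + g i) ≤
      -c₁ * h * (y ⬝ᵥ y) - (c₂ - M) * ∑ i, |y i| := by
    simp only [dotProduct, Finset.mul_sum, ← Finset.sum_sub_distrib]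
    exact Finset.sum_le_sum fun i _ => term i
  linear_combination total + h * quad
end
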